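/- arXiv:1803.08906 — 2 statements merged into one kernel-verified Lean document; each statement's English description precedes it below -/
import Mathlib

section
/- Let G be a group, let X be an algebraic variety over an algebraically closed field K, let A := X(K), and let τ : A^G → A^G be an algebraic cellular automaton over (G,X,K). Let Γ ⊆ A^G and Φ := τ(Γ). Then: (i) if Γ_Ω is a constructible subset of A^Ω for every finite subset Ω ⊆ G, then Φ_Ω is a constructible subset of A^Ω for every finite subset Ω ⊆ G; (ii) if X is complete and Γ_Ω is Zariski-closed in A^Ω for every finite subset Ω ⊆ G, then Φ_Ω is Zariski-closed in A^Ω for every finite subset Ω ⊆ G. -/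
open AlgebraicGeometry CategoryTheory CategoryTheory.Limits Filter Topology
open scoped ENNReal NNReal

noncomputable section

namespace GOE

/-! ## Følner nets and amenability -/

/-- A (right) Følner net for a group `G`: a net of nonempty finite subsets `F i ⊆ G`,
indexed by a directed nonempty preorder, such that `|F i \ F i g| / |F i| → 0` for every
`g ∈ G`. -/
structure FolnerNet (G : Type) [Group G] where
  ι : Type
  [pre : Preorder ι]
  [ne : Nonempty ι]
  [dir : IsDirected ι (· ≤ ·)]
  F : ι → Finset G
  nonempty : ∀ i, (F i).Nonempty
  folner : ∀ g : G,
    Filter.Tendsto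
      (fun i => ((((F i : Set G) \ ((· * g) '' (F i : Set G))).ncard : ℝ) / ((F i).card : ℝ)))
      Filter.atTop (nhds 0)

attribute [instance] FolnerNet.pre FolnerNet.ne FolnerNet.dir

/-- A group is amenable if it admits a Følner net. -/
def Amenable (G : Type) [Group G] : Prop := Nonempty (FolnerNet G)

/-! ## Constructible subsets of a topological space -/

/-- A subset of a topological space is constructible if it is a finite union of
locally closed subsets. -/
def IsConstr {X : Type} [TopologicalSpace X] (C : Set X) : Prop :=
  ∃ (n : ℕ) (U Z : Fin n → Set X), (∀ i, IsOpen (U i)) ∧ (∀ i, IsClosed (Z i)) ∧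
    C = ⋃ i, U i ∩ Z i

/-- Conversion of a Krull dimension (an element of `WithBot ℕ∞`) to an extended real. -/
def dimE (d : WithBot ℕ∞) : EReal :=
  WithBot.recBotCoe ⊥ (fun n : ℕ∞ => ((n : ℝ≥0∞) : EReal)) d

/-! ## Varieties over a field and their points -/

variable (K : Type) [Field K]

/-- The spectrum of the field `K`, as a scheme. -/
abbrev SpecK : Scheme := Spec (CommRingCat.of K)

/-- The unique point of `Spec K`. -/
def specPt : SpecK K := (⟨⊥, Ideal.bot_prime⟩ : PrimeSpectrum K)

instance : HasFiniteProducts (Over (SpecK K)) :=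
  CategoryTheory.Over.ConstructProducts.over_finiteProducts_of_finiteWidePullbacks

/-- The set of `K`-points of a `K`-scheme, i.e. sections of the structure morphism,
i.e. morphisms `Spec K ⟶ X` over `Spec K`. -/
abbrev Pt (W : Over (SpecK K)) : Type := Over.mk (𝟙 (SpecK K)) ⟶ W

/-- The image in (the underlying space of) `W` of a `K`-point of `W`. -/
def ev {W : Over (SpecK K)} (a : Pt K W) : W.left := a.left.base (specPt K)

/-- The fibered power `X^Ω` over `Spec K` of a `K`-scheme `X`, for a finite index set `Ω`. -/
def pow (V : Over (SpecK K)) (Ω : Type) [Finite Ω] : Over (SpecK K) :=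
  ∏ᶜ (fun _ : Ω => V)

/-- The canonical identification of families of `K`-points indexed by `Ω` with
`K`-points of the fibered power `X^Ω`. -/
def ptPow (V : Over (SpecK K)) (Ω : Type) [Finite Ω] (a : Ω → Pt K V) :
    Pt K (pow K V Ω) := Pi.lift a

variable (V : Over (SpecK K))

/-- The Krull dimension of (the underlying space of) a `K`-scheme. -/
def vdim : WithBot ℕ∞ := topologicalKrullDim V.left

/-- The Zariski topology on `A^Ω` (`A` the set of `K`-points of `X`), induced from the
Zariski topology of the fibered power `X^Ω` via the identification of `A^Ω` with a
subset (the set of closed points, for `K` algebraically closed) of `X^Ω`. -/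
def cfgTop (Ω : Type) [Finite Ω] : TopologicalSpace (Ω → Pt K V) :=
  TopologicalSpace.induced (fun u => ev K (ptPow K V Ω u)) inferInstance

/-- The Krull dimension of a subset `D ⊆ A^Ω` for the Zariski topology. -/
def cfgDim (Ω : Type) [Finite Ω] (D : Set (Ω → Pt K V)) : WithBot ℕ∞ :=
  letI := cfgTop K V Ω
  topologicalKrullDim D

/-- `D ⊆ A^Ω` is closed for the Zariski topology. -/
def cfgClosed (Ω : Type) [Finite Ω] (D : Set (Ω → Pt K V)) : Prop :=
  letI := cfgTop K V Ω
  IsClosed D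

/-- `D ⊆ A^Ω` is constructible for the Zariski topology. -/
def cfgConstr (Ω : Type) [Finite Ω] (D : Set (Ω → Pt K V)) : Prop :=
  letI := cfgTop K V Ω
  IsConstr D

/-! ## Configurations, restrictions, cylinders -/

variable {G : Type} [Group G]

/-- The restriction `Γ_Ω ⊆ A^Ω` of a set of configurations `Γ ⊆ A^G`. -/
def restr (Γ : Set (G → Pt K V)) (Ω : Finset G) : Set (↥Ω → Pt K V) :=
  (fun c (ω : ↥Ω) => c ω) '' Γ

/-- The cylinder `D_p ⊆ A^G`: configurations restricting to an element of `D` on `Ω` and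
to `p` on `G ∖ Ω`. -/
def cyl (Ω : Finset G) (D : Set (↥Ω → Pt K V)) (p : {g : G // g ∉ Ω} → Pt K V) :
    Set (G → Pt K V) :=
  {c | (fun ω : ↥Ω => c ω) ∈ D ∧ ∀ (g : G) (h : g ∉ Ω), c g = p ⟨g, h⟩}

/-- Algebraic mean dimension of `Γ ⊆ A^G` with respect to a Følner net. -/
def mdim (𝓕 : FolnerNet G) (Γ : Set (G → Pt K V)) : EReal :=
  Filter.limsup
    (fun i => dimE (cfgDim K V ↥(𝓕.F i) (restr K V Γ (𝓕.F i))) *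
      ((((𝓕.F i).card : ℝ)⁻¹ : ℝ) : EReal))
    Filter.atTop

/-! ## Cellular automata -/

/-- `τ : A^G → A^G` is an algebraic cellular automaton over `(G, X, K)`: it admits a finite
memory set `M ⊆ G` whose associated local defining map `A^M → A` is induced by a morphism
of `K`-schemes `f : X^M → X`. -/
def IsAlgCA (τ : (G → Pt K V) → (G → Pt K V)) : Prop :=
  ∃ (M : Finset G) (f : pow K V ↥M ⟶ V),
    ∀ (x : G → Pt K V) (g : G),
      τ x g = ptPow K V ↥M (fun m => x (g * (m : G))) ≫ f

/-- Pre-injectivity: configurations that are almost equal and have the same image are equal. -/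
def PreInjective (τ : (G → Pt K V) → (G → Pt K V)) : Prop :=
  ∀ c₁ c₂ : G → Pt K V, {g : G | c₁ g ≠ c₂ g}.Finite → τ c₁ = τ c₂ → c₁ = c₂

/-- `(*)`-pre-injectivity: there exist no finite subset `Ω ⊆ G` and Zariski-closed proper
subset `H ⊊ A^Ω` such that `τ((A^Ω)_p) = τ(H_p)` for all `p ∈ A^{G∖Ω}`. -/
def StarPreInjective (τ : (G → Pt K V) → (G → Pt K V)) : Prop :=
  ¬ ∃ (Ω : Finset G) (H : Set (↥Ω → Pt K V)), cfgClosed K V ↥Ω H ∧ H ≠ Set.univ ∧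
      ∀ p : {g : G // g ∉ Ω} → Pt K V,
        τ '' cyl K V Ω Set.univ p = τ '' cyl K V Ω H p

/-- `(**)`-pre-injectivity: there is no finite subset `Ω ⊆ G` such that, for every
`p ∈ A^{G∖Ω}`, the finite-support set `τ((A^Ω)_p)` (written as some `R_s`) satisfies
`dim(R) < dim(A^Ω)`. -/
def StarStarPreInjective (τ : (G → Pt K V) → (G → Pt K V)) : Prop :=
  ¬ ∃ Ω : Finset G, ∀ p : {g : G // g ∉ Ω} → Pt K V,
      ∃ (Λ : Finset G) (R : Set (↥Λ → Pt K V)) (s : {g : G // g ∉ Λ} → Pt K V),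
        τ '' cyl K V Ω Set.univ p = cyl K V Λ R s ∧
        cfgDim K V ↥Λ R < cfgDim K V ↥Ω (Set.univ : Set (↥Ω → Pt K V))

/-- `Γ ⊆ A^G` is closed for the prodiscrete topology on `A^G`. -/
def ProdiscreteClosed {A : Type} (Γ : Set (G → A)) : Prop :=
  letI : TopologicalSpace A := ⊥
  IsClosed Γ

/-- `Γ ⊆ A^G` is invariant under the shift action of `G`. -/
def ShiftInvariant {A : Type} (Γ : Set (G → A)) : Prop :=
  ∀ (g : G), ∀ c ∈ Γ, (fun h : G => c (g⁻¹ * h)) ∈ Γ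

/-- An `(E,E')`-tiling of `G`. -/
def IsTiling (E E' : Finset G) (T : Set G) : Prop :=
  (∀ g ∈ T, ∀ h ∈ T, g ≠ h →
    Disjoint ((g * ·) '' (E : Set G)) ((h * ·) '' (E : Set G))) ∧
  ∀ x : G, ∃ g ∈ T, x ∈ (g * ·) '' (E' : Set G)


/-! ## Constructible sets and inducing maps -/

section Topology

variable {X Y : Type} [TopologicalSpace X] [TopologicalSpace Y]

lemma IsConstr.isConstructible [TopologicalSpace.NoetherianSpace X] {C : Set X} (hC : IsConstr C) :
    IsConstructible C := by
  obtain ⟨n, U, Z, hU, hZ, rfl⟩ := hC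
  have hopen {O : Set X} (hO : IsOpen O) : IsConstructible O :=
    IsRetrocompact.isConstructible hO fun _ _ _ ↦ TopologicalSpace.NoetherianSpace.isCompact _
  refine .iUnion fun i ↦ (hopen (hU i)).inter ?_
  simpa using (hopen (hZ i).isOpen_compl).compl

lemma isConstr_of_isLocallyClosed {C : Set X} (hC : IsLocallyClosed C) : IsConstr C := by
  obtain ⟨U, Z, hU, hZ, rfl⟩ := hC
  exact ⟨1, fun _ ↦ U, fun _ ↦ Z, fun _ ↦ hU, fun _ ↦ hZ, (Set.iUnion_const _).symm⟩

lemma IsConstr.union {C D : Set X} (hC : IsConstr C) (hD : IsConstr D) : IsConstr (C ∪ D) := by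
  obtain ⟨n, U, Z, hU, hZ, rfl⟩ := hC
  obtain ⟨m, U', Z', hU', hZ', rfl⟩ := hD
  refine ⟨n + m, Fin.append U U', Fin.append Z Z', fun i ↦ ?_, fun i ↦ ?_, ?_⟩
  · induction i using Fin.addCases <;> simp [hU, hU']
  · induction i using Fin.addCases <;> simp [hZ, hZ']
  · ext x
    simp only [Set.mem_union, Set.mem_iUnion]
    constructor
    · rintro (⟨i, hi⟩ | ⟨i, hi⟩)
      · exact ⟨Fin.castAdd m i, by simpa using hi⟩
      · exact ⟨Fin.natAdd n i, by simpa using hi⟩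
    · rintro ⟨i, hi⟩
      induction i using Fin.addCases with
      | left i => exact .inl ⟨i, by simpa using hi⟩
      | right i => exact .inr ⟨i, by simpa using hi⟩

lemma IsConstr.iUnion {n : ℕ} {C : Fin n → Set X} (hC : ∀ i, IsConstr (C i)) :
    IsConstr (⋃ i, C i) := by
  induction n with
  | zero => simpa using isConstr_of_isLocallyClosed isOpen_empty.isLocallyClosed
  | succ n ih =>
    have : ⋃ i, C i = C 0 ∪ ⋃ i : Fin n, C i.succ := by
      ext x; simp [Fin.exists_fin_succ]
    rw [this]
    exact (hC 0).union (ih fun i ↦ hC i.succ)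

lemma IsConstr.compl {C : Set X} (hC : IsConstr C) : IsConstr Cᶜ := by
  have inter {C D : Set X} (hC : IsConstr C) (hD : IsConstr D) : IsConstr (C ∩ D) := by
    obtain ⟨n, U, Z, hU, hZ, rfl⟩ := hC
    obtain ⟨m, U', Z', hU', hZ', rfl⟩ := hD
    rw [Set.iUnion_inter]
    refine .iUnion fun i ↦ ?_
    rw [Set.inter_iUnion]
    refine .iUnion fun j ↦ isConstr_of_isLocallyClosed ?_
    exact ((hU i).isLocallyClosed.inter (hZ i).isLocallyClosed).inter
      ((hU' j).isLocallyClosed.inter (hZ' j).isLocallyClosed)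
  obtain ⟨n, U, Z, hU, hZ, rfl⟩ := hC
  rw [Set.compl_iUnion]
  induction n with
  | zero => simpa using isConstr_of_isLocallyClosed isOpen_univ.isLocallyClosed
  | succ n ih =>
    have : ⋂ i, (U i ∩ Z i)ᶜ = (U 0 ∩ Z 0)ᶜ ∩ ⋂ i : Fin n, (U i.succ ∩ Z i.succ)ᶜ := by
      ext x
      simp only [Set.mem_iInter, Set.mem_inter_iff, Fin.forall_fin_succ]
    rw [this]
    refine inter ?_ (ih _ _ (fun i ↦ hU i.succ) fun i ↦ hZ i.succ)
    rw [Set.compl_inter]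
    exact (isConstr_of_isLocallyClosed (hU 0).isClosed_compl.isLocallyClosed).union
      (isConstr_of_isLocallyClosed (hZ 0).isOpen_compl.isLocallyClosed)

lemma isConstr_of_isConstructible {C : Set X} (hC : IsConstructible C) : IsConstr C := by
  induction hC using IsConstructible.empty_union_induction with
  | open_retrocompact U hU _ => exact isConstr_of_isLocallyClosed hU.isLocallyClosed
  | union s _ t _ hs ht => exact hs.union ht
  | compl s _ hs => exact hs.compl

lemma IsConstr.preimage {f : X → Y} (hf : Continuous f) {C : Set Y} (hC : IsConstr C) :
    IsConstr (f ⁻¹' C) := by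
  obtain ⟨n, U, Z, hU, hZ, rfl⟩ := hC
  exact ⟨n, fun i ↦ f ⁻¹' U i, fun i ↦ f ⁻¹' Z i, fun i ↦ (hU i).preimage hf,
    fun i ↦ (hZ i).preimage hf, by simp [Set.preimage_iUnion]⟩

lemma IsConstr.exists_preimage_eq {f : X → Y} (hf : IsInducing f) {C : Set X}
    (hC : IsConstr C) : ∃ D, IsConstr D ∧ f ⁻¹' D = C := by
  obtain ⟨n, U, Z, hU, hZ, rfl⟩ := hC
  choose U' hU' hUU' using fun i ↦ hf.isOpen_iff.mp (hU i)
  choose Z' hZ' hZZ' using fun i ↦ hf.isClosed_iff.mp (hZ i)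
  exact ⟨_, ⟨n, U', Z', hU', hZ', rfl⟩, by simp [Set.preimage_iUnion, hUU', hZZ']⟩

/-- Taking images commutes with passing to closed points, for constructible subsets of a
Jacobson space. -/
lemma image_preimage_eq_preimage_image_of_isConstr [JacobsonSpace X] {P Q : Type}
    {e : P → X} {e' : Q → Y} {F : X → Y} {T : P → Q} (hF : Continuous F)
    (hcomm : ∀ p, e' (T p) = F (e p)) (he : closedPoints X ⊆ Set.range e)
    (he' : Function.Injective e') (hQ : ∀ q, IsClosed {e' q}) {C : Set X} (hC : IsConstr C) :
    T '' (e ⁻¹' C) = e' ⁻¹' (F '' C) := by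
  apply subset_antisymm
  · rintro _ ⟨p, hp, rfl⟩
    exact ⟨e p, hp, (hcomm p).symm⟩
  · rintro q ⟨x, hx, hxq⟩
    obtain ⟨n, U, Z, hU, hZ, rfl⟩ := hC
    obtain ⟨i, hi⟩ := Set.mem_iUnion.mp hx
    obtain ⟨y, ⟨hy, hyq⟩, hyc⟩ := nonempty_inter_closedPoints
      (Z := (U i ∩ Z i) ∩ F ⁻¹' {e' q}) ⟨x, hi, hxq⟩
      (((hU i).isLocallyClosed.inter (hZ i).isLocallyClosed).inter
        ((hQ q).preimage hF).isLocallyClosed)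
    obtain ⟨p, rfl⟩ := he hyc
    exact ⟨p, Set.mem_iUnion.mpr ⟨i, hy⟩, he' ((hcomm p).trans hyq)⟩

end Topology

/-! ## Points of fibered powers -/

section Points

lemma prop_pow_hom {K : Type} [Field K] (P : MorphismProperty Scheme) [P.IsMultiplicative]
    [P.IsStableUnderBaseChange] {V : Over (SpecK K)} (hV : P V.hom) (Ω : Type) [Finite Ω] :
    P (pow K V Ω).hom := by
  have : (P.overObj (X := SpecK K)).IsClosedUnderBinaryProducts := by
    refine ⟨?_⟩
    rintro Z ⟨p⟩
    let c : BinaryFan (p.diag.obj ⟨.left⟩) (p.diag.obj ⟨.right⟩) :=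
      (Cone.postcompose (diagramIsoPair p.diag).hom).obj ⟨Z, p.π⟩
    have hc : IsLimit c := (IsLimit.postcomposeHomEquiv (diagramIsoPair p.diag) _).symm p.isLimit
    have sq := Over.isPullback_of_binaryFan_isLimit c hc
    have w : c.fst.left ≫ (p.diag.obj ⟨.left⟩).hom = Z.hom := Over.w c.fst
    change P Z.hom
    rw [← w]
    exact P.comp_mem _ _ (P.of_isPullback sq.flip (p.prop_diag_obj ⟨.right⟩))
      (p.prop_diag_obj ⟨.left⟩)
  have : (P.overObj (X := SpecK K)).IsClosedUnderFiniteProducts := .mk'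
  exact ObjectProperty.prop_product (P := P.overObj (X := SpecK K)) fun _ : Ω ↦ hV

variable (K : Type) [Field K]

/-- The projections of a fibered power. -/
def powProj (V : Over (SpecK K)) {Ω : Type} [Finite Ω] (ω : Ω) : pow K V Ω ⟶ V :=
  Pi.π (fun _ : Ω ↦ V) ω

/-- The morphism to a fibered power with given components. -/
def powLift {W V : Over (SpecK K)} {Ω : Type} [Finite Ω] (f : Ω → (W ⟶ V)) : W ⟶ pow K V Ω :=
  Pi.lift f

lemma powLift_powProj {W V : Over (SpecK K)} {Ω : Type} [Finite Ω] (f : Ω → (W ⟶ V)) (ω : Ω) :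
    powLift K f ≫ powProj K V ω = f ω :=
  Pi.lift_π _ _

lemma ptPow_powProj (V : Over (SpecK K)) {Ω : Type} [Finite Ω] (u : Ω → Pt K V) (ω : Ω) :
    ptPow K V Ω u ≫ powProj K V ω = u ω :=
  Pi.lift_π _ _

variable {K} in
lemma pow_hom_ext {W V : Over (SpecK K)} {Ω : Type} [Finite Ω] {f g : W ⟶ pow K V Ω}
    (h : ∀ ω, f ≫ powProj K V ω = g ≫ powProj K V ω) : f = g :=
  Pi.hom_ext _ _ h

lemma ptPow_bijective (V : Over (SpecK K)) (Ω : Type) [Finite Ω] :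
    Function.Bijective (ptPow K V Ω) := by
  refine ⟨fun u v h ↦ funext fun ω ↦ ?_, fun p ↦ ⟨fun ω ↦ p ≫ powProj K V ω, ?_⟩⟩
  · rw [← ptPow_powProj K V u, h, ptPow_powProj]
  · exact pow_hom_ext fun ω ↦ ptPow_powProj ..

lemma ev_comp {W Y : Over (SpecK K)} (p : Pt K W) (F : W ⟶ Y) :
    ev K (p ≫ F) = F.left (ev K p) := rfl

lemma closedPoint_eq_specPt : IsLocalRing.closedPoint K = specPt K :=
  Subsingleton.elim (α := PrimeSpectrum K) _ _

variable [IsAlgClosed K] (W : Over (SpecK K)) [LocallyOfFiniteType W.hom]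

lemma ev_injective : Function.Injective (ev K (W := W)) := fun p q h ↦ by
  ext1
  refine ext_of_apply_closedPoint_eq W.hom (Over.w p) (Over.w q) ?_
  rw [closedPoint_eq_specPt]
  exact h

lemma range_ev : Set.range (ev K (W := W)) = closedPoints W.left := by
  ext x
  constructor
  · rintro ⟨p, rfl⟩
    have := (pointEquivClosedPoint W.hom ⟨p.left, Over.w p⟩).2
    rw [pointEquivClosedPoint_apply_coe, closedPoint_eq_specPt] at this
    exact this
  · intro hx
    exact ⟨Over.homMk (pointOfClosedPoint W.hom x hx) (pointOfClosedPoint_comp W.hom x hx),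
      pointOfClosedPoint_apply W.hom x hx _⟩

end Points

/-! ## Images of families of points under morphisms of fibered powers -/

section Image

variable {K : Type} [Field K] {V : Over (SpecK K)} {E Ω : Type} [Finite E] [Finite Ω]
  {F : pow K V E ⟶ pow K V Ω} {T : (E → Pt K V) → (Ω → Pt K V)}

lemma isInducing_ev_ptPow (Ω : Type) [Finite Ω] :
    @IsInducing _ _ (cfgTop K V Ω) _ fun u ↦ ev K (ptPow K V Ω u) :=
  letI := cfgTop K V Ω
  ⟨rfl⟩

lemma isNoetherian_pow_left [LocallyOfFiniteType V.hom] [QuasiCompact V.hom] (Ω : Type)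
    [Finite Ω] : IsNoetherian (pow K V Ω).left := by
  have := prop_pow_hom @LocallyOfFiniteType (V := V) inferInstance Ω
  have := prop_pow_hom @QuasiCompact (V := V) inferInstance Ω
  have := LocallyOfFiniteType.isLocallyNoetherian (pow K V Ω).hom
  have : CompactSpace (pow K V Ω).left :=
    QuasiCompact.compactSpace_of_compactSpace (pow K V Ω).hom
  exact { }

variable [IsAlgClosed K]

lemma image_preimage_ev_ptPow [LocallyOfFiniteType V.hom]
    (hT : ∀ u, ptPow K V Ω (T u) = ptPow K V E u ≫ F) {C : Set (pow K V E).left}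
    (hC : IsConstr C) :
    T '' ((fun u ↦ ev K (ptPow K V E u)) ⁻¹' C) =
      (fun u ↦ ev K (ptPow K V Ω u)) ⁻¹' (F.left '' C) := by
  have := prop_pow_hom @LocallyOfFiniteType (V := V) inferInstance E
  have := prop_pow_hom @LocallyOfFiniteType (V := V) inferInstance Ω
  have : JacobsonSpace (pow K V E).left := LocallyOfFiniteType.jacobsonSpace (pow K V E).hom
  refine image_preimage_eq_preimage_image_of_isConstr F.left.continuous
    (fun u ↦ by rw [Function.comp_apply, hT, ev_comp]) ?_ ((ev_injective K _).comp (ptPow_bijective K V Ω).1)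
    (fun u ↦ ?_) hC
  · rw [← range_ev]
    exact ((ptPow_bijective K V E).2.range_comp (ev K)).superset
  · exact (range_ev K (pow K V Ω)).subset ⟨_, rfl⟩

lemma cfgConstr.image [LocallyOfFiniteType V.hom] [QuasiCompact V.hom]
    (hT : ∀ u, ptPow K V Ω (T u) = ptPow K V E u ≫ F) {D : Set (E → Pt K V)}
    (hD : cfgConstr K V E D) : cfgConstr K V Ω (T '' D) := by
  let := cfgTop K V E
  let := cfgTop K V Ω
  obtain ⟨C, hC, rfl⟩ := IsConstr.exists_preimage_eq (isInducing_ev_ptPow E) hD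
  rw [image_preimage_ev_ptPow hT hC]
  have := isNoetherian_pow_left (V := V) E
  have := isNoetherian_pow_left (V := V) Ω
  have := prop_pow_hom @LocallyOfFiniteType (V := V) inferInstance E
  have : LocallyOfFiniteType (F.left ≫ (pow K V Ω).hom) := by rwa [Over.w]
  have : LocallyOfFiniteType F.left := locallyOfFiniteType_of_comp F.left (pow K V Ω).hom
  have : LocallyOfFinitePresentation F.left :=
    LocallyOfFinitePresentation.iff_locallyOfFiniteType.mpr this
  exact (isConstr_of_isConstructible (F.left.isConstructible_image hC.isConstructible)).preimage
    (isInducing_ev_ptPow Ω).continuous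

lemma cfgClosed.image [IsProper V.hom]
    (hT : ∀ u, ptPow K V Ω (T u) = ptPow K V E u ≫ F) {D : Set (E → Pt K V)}
    (hD : cfgClosed K V E D) : cfgClosed K V Ω (T '' D) := by
  let := cfgTop K V E
  let := cfgTop K V Ω
  obtain ⟨C, hC, rfl⟩ := (isInducing_ev_ptPow E).isClosed_iff.mp hD
  rw [image_preimage_ev_ptPow hT (isConstr_of_isLocallyClosed hC.isLocallyClosed)]
  have := prop_pow_hom @IsProper (V := V) inferInstance E
  have := prop_pow_hom @IsProper (V := V) inferInstance Ω
  have : IsProper (F.left ≫ (pow K V Ω).hom) := by rwa [Over.w]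
  have : IsProper F.left := IsProper.of_comp F.left (pow K V Ω).hom
  exact (F.left.isClosedMap _ hC).preimage (isInducing_ev_ptPow Ω).continuous

end Image

/-- The restriction to `Ω` of the image of a cellular automaton with memory set `M` is the image
of the restriction to `ΩM` under a morphism of fibered powers. -/
lemma IsAlgCA.exists_restr_image_eq {K : Type} [Field K] {V : Over (SpecK K)} {G : Type} [Group G]
    {τ : (G → Pt K V) → (G → Pt K V)} (hτ : IsAlgCA K V τ) (Ω : Finset G) :
    ∃ (E : Finset G) (F : pow K V E ⟶ pow K V Ω) (T : (E → Pt K V) → (Ω → Pt K V)),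
      (∀ u, ptPow K V Ω (T u) = ptPow K V E u ≫ F) ∧
      ∀ Γ, restr K V (τ '' Γ) Ω = T '' restr K V Γ E := by
  classical
  obtain ⟨M, f, hf⟩ := hτ
  let E : Finset G := Finset.image₂ (· * ·) Ω M
  let r (ω : Ω) (m : M) : E := ⟨ω * m, Finset.mem_image₂_of_mem ω.2 m.2⟩
  refine ⟨E, powLift K fun ω ↦ powLift K (fun m ↦ powProj K V (r ω m)) ≫ f,
    fun u ω ↦ ptPow K V M (fun m ↦ u (r ω m)) ≫ f, fun u ↦ pow_hom_ext fun ω ↦ ?_, fun Γ ↦ ?_⟩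
  · have : ptPow K V M (fun m ↦ u (r ω m)) =
        ptPow K V E u ≫ powLift K (fun m ↦ powProj K V (r ω m)) :=
      pow_hom_ext fun m ↦ by rw [Category.assoc, powLift_powProj, ptPow_powProj, ptPow_powProj]
    rw [ptPow_powProj, Category.assoc, powLift_powProj, ← Category.assoc, ← this]
  · simp only [restr, Set.image_image]
    refine Set.image_congr fun c _ ↦ funext fun ω ↦ ?_
    rw [hf]

/-- Proposition 3.3. Let `G` be a group, `X` an algebraic variety over
an algebraically closed field `K`, `A := X(K)`, `τ` an algebraic cellular automaton over
`(G,X,K)`, `Γ ⊆ A^G` and `Φ := τ(Γ)`. (i) If every restriction `Γ_Ω` is constructible,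
then so is every `Φ_Ω`; (ii) if `X` is complete and every `Γ_Ω` is Zariski-closed, then
so is every `Φ_Ω`. -/
theorem image_restriction_constructible_and_closed
    (G : Type) [Group G]
    (K : Type) [Field K] [IsAlgClosed K]
    (V : Over (SpecK K)) (hft : LocallyOfFiniteType V.hom) (hqc : QuasiCompact V.hom)
    (τ : (G → Pt K V) → (G → Pt K V)) (hca : IsAlgCA K V τ)
    (Γ : Set (G → Pt K V)) :
    ((∀ Ω : Finset G, cfgConstr K V ↥Ω (restr K V Γ Ω)) →
        ∀ Ω : Finset G, cfgConstr K V ↥Ω (restr K V (τ '' Γ) Ω)) ∧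
    (IsProper V.hom →
      (∀ Ω : Finset G, cfgClosed K V ↥Ω (restr K V Γ Ω)) →
        ∀ Ω : Finset G, cfgClosed K V ↥Ω (restr K V (τ '' Γ) Ω)) := by
  refine ⟨fun h Ω ↦ ?_, fun hp h Ω ↦ ?_⟩ <;>
    obtain ⟨E, F, T, hT, hΓ⟩ := hca.exists_restr_image_eq Ω <;> rw [hΓ]
  · exact (h E).image hT
  · exact (h E).image hT

end GOE
end
end

section
/- Let G be an amenable group with a Følner net F = (F_i)_{i∈I}, let X be an irreducible algebraic variety over an algebraically closed field K, and let A := X(K). Suppose Γ ⊆ A^G is such that there exist finite subsets E, E' ⊆ G and an (E,E')-tiling T ⊆ G with the property that for every g ∈ T the restriction Γ_{gE} is a proper Zariski-closed subset of A^{gE}. Then mdim_F(Γ) < dim(X). -/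
open AlgebraicGeometry CategoryTheory CategoryTheory.Limits Filter Topology
open scoped ENNReal NNReal

noncomputable section

namespace GOE

/-! ## Varieties over a field and their points -/

variable (K : Type) [Field K]

variable (V : Over (SpecK K))

/-! ## Configurations, restrictions, cylinders -/

variable {G : Type} [Group G]

/-! ## Dimension theory -/

theorem natCast_lt_top (n : ℕ) : (n : WithBot ℕ∞) < ⊤ :=
  WithBot.coe_lt_coe.2 (ENat.natCast_lt_top n)

theorem exists_nat_ge_of_lt_top {d : WithBot ℕ∞} (hd : d < ⊤) : ∃ n : ℕ, d ≤ n := by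
  induction d with
  | bot => exact ⟨0, bot_le⟩
  | coe d =>
    lift d to ℕ using (WithBot.coe_lt_coe.1 hd).ne
    exact ⟨d, le_rfl⟩

theorem ringKrullDim_le_of_isIntegral {R S : Type*} [CommRing R] [CommRing S] (f : R →+* S)
    (hf : f.IsIntegral) : ringKrullDim S ≤ ringKrullDim R := by
  algebraize [f]
  have : Algebra.IsIntegral R S := ⟨hf⟩
  exact Order.krullDim_le_of_strictMono (PrimeSpectrum.comap (algebraMap R S))
    fun I J h => Ideal.IsIntegral.comap_lt_comap h

theorem ringKrullDim_eq_of_isIntegral_of_injective {R S : Type*} [CommRing R] [IsDomain R]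
    [CommRing S] (f : R →+* S) (hf : f.IsIntegral) (hinj : Function.Injective f) :
    ringKrullDim S = ringKrullDim R := by
  refine le_antisymm (ringKrullDim_le_of_isIntegral f hf) ?_
  algebraize [f]
  have : Algebra.IsIntegral R S := ⟨hf⟩
  have : FaithfulSMul R S := (faithfulSMul_iff_algebraMap_injective R S).2 hinj
  refine iSup_le fun l => ?_
  obtain ⟨⟨P, hP, hPl⟩⟩ := Ideal.nonempty_primesOver (S := S) l.head.asIdeal
  obtain ⟨L, hL, -⟩ := Ideal.exists_ltSeries_of_hasGoingUp l P
  rw [← hL]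
  exact Order.LTSeries.length_le_krullDim L

theorem isIntegralElem_of_comp_eq {K P Q A C : Type*} [CommRing K] [CommRing P] [CommRing Q]
    [CommRing A] [CommRing C] [Algebra K P] [Algebra K Q] [Algebra K A] [Algebra K C]
    {k : Q →ₐ[K] A} {ι : A →ₐ[K] C} {r : Q →ₐ[K] P} {φ : P →ₐ[K] C}
    (hk : k.toRingHom.IsIntegral) (hc : φ.comp r = ι.comp k) (a : A) :
    φ.toRingHom.IsIntegralElem (ι a) := by
  obtain ⟨p, hp, hpa⟩ := hk a
  refine ⟨p.map r.toRingHom, hp.map _, ?_⟩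
  have e : φ.toRingHom.comp r.toRingHom = ι.toRingHom.comp k.toRingHom :=
    congrArg AlgHom.toRingHom hc
  have := Polynomial.hom_eval₂ p k.toRingHom ι.toRingHom a
  rw [hpa, map_zero] at this
  rw [Polynomial.eval₂_map, e]
  exact this.symm

open scoped TensorProduct in
theorem ringKrullDim_tensorProduct_le (K A B : Type*) [Field K] [CommRing A] [CommRing B]
    [Algebra K A] [Algebra K B] [Algebra.FiniteType K A] [Algebra.FiniteType K B] :
    ringKrullDim (A ⊗[K] B) ≤ ringKrullDim A + ringKrullDim B := by
  cases subsingleton_or_nontrivial (A ⊗[K] B) with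
  | inl h => simp [ringKrullDim_eq_bot_of_subsingleton]
  | inr h =>
  have hA : Nontrivial A :=
    (Algebra.TensorProduct.includeLeft : A →ₐ[K] A ⊗[K] B).toRingHom.domain_nontrivial
  have hB : Nontrivial B :=
    (Algebra.TensorProduct.includeRight : B →ₐ[K] A ⊗[K] B).toRingHom.domain_nontrivial
  obtain ⟨s, g, hg, hgi⟩ := exists_integral_inj_algHom_of_fg K A
  obtain ⟨t, h, hh, hhi⟩ := exists_integral_inj_algHom_of_fg K B
  rw [ringKrullDim_eq_of_isIntegral_of_injective g.toRingHom hgi hg,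
    ringKrullDim_eq_of_isIntegral_of_injective h.toRingHom hhi hh]
  let φ : MvPolynomial (Fin s ⊕ Fin t) K →ₐ[K] A ⊗[K] B :=
    MvPolynomial.aeval (Sum.elim (fun i => g (.X i) ⊗ₜ 1) (fun j => 1 ⊗ₜ h (.X j)))
  have hl : φ.comp (MvPolynomial.rename Sum.inl) =
      Algebra.TensorProduct.includeLeft.comp g := by
    ext i; simp [φ]
  have hr : φ.comp (MvPolynomial.rename Sum.inr) =
      Algebra.TensorProduct.includeRight.comp h := by
    ext i; simp [φ]
  have hφ : φ.toRingHom.IsIntegral := by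
    intro x
    induction x with
    | zero => exact RingHom.isIntegralElem_zero _
    | add x y hx hy => exact RingHom.IsIntegralElem.add _ hx hy
    | tmul a b =>
      have e : a ⊗ₜ[K] b = (Algebra.TensorProduct.includeLeft : A →ₐ[K] A ⊗[K] B) a *
        (Algebra.TensorProduct.includeRight : B →ₐ[K] A ⊗[K] B) b := by simp
      rw [e]
      exact RingHom.IsIntegralElem.mul _ (isIntegralElem_of_comp_eq hgi hl a)
        (isIntegralElem_of_comp_eq hhi hr b)
  refine (ringKrullDim_le_of_isIntegral φ.toRingHom hφ).trans ?_
  simp [MvPolynomial.ringKrullDim_of_isNoetherianRing]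

theorem ringKrullDim_lt_top_of_finiteType (K A : Type*) [Field K] [CommRing A]
    [Algebra K A] [Algebra.FiniteType K A] : ringKrullDim A < ⊤ := by
  cases subsingleton_or_nontrivial A with
  | inl h => simp [ringKrullDim_eq_bot_of_subsingleton]
  | inr h =>
  obtain ⟨s, g, hg, hgi⟩ := exists_integral_inj_algHom_of_fg K A
  rw [ringKrullDim_eq_of_isIntegral_of_injective g.toRingHom hgi hg]
  simpa [MvPolynomial.ringKrullDim_of_isNoetherianRing] using natCast_lt_top s

theorem topologicalKrullDim_le_of_isOpenEmbedding_cover {T ι : Type*} [TopologicalSpace T]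
    {U : ι → Type*} [∀ i, TopologicalSpace (U i)] (f : ∀ i, U i → T)
    (hf : ∀ i, IsOpenEmbedding (f i)) (hcov : ∀ x, ∃ i, x ∈ Set.range (f i))
    {d : WithBot ℕ∞} (hd : ∀ i, topologicalKrullDim (U i) ≤ d) : topologicalKrullDim T ≤ d := by
  rw [topologicalKrullDim, Order.krullDim_eq_iSup_coheight]
  refine iSup_le fun Z => ?_
  obtain ⟨x, hx⟩ := Z.isIrreducible.nonempty
  obtain ⟨i, y, rfl⟩ := hcov x
  let e := TopologicalSpace.IrreducibleCloseds.orderIsoOfIsOpenEmbedding (f i) (hf i)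
  obtain ⟨Z', hZ'⟩ := e.surjective ⟨Z, ⟨y, hx⟩⟩
  have : TopologicalSpace.IrreducibleCloseds.map (f i) (hf i).continuous Z' = Z :=
    congrArg Subtype.val hZ'
  rw [← this, (hf i).coheight_map]
  exact (Order.coheight_le_krullDim _).trans (hd i)

theorem topologicalKrullDim_le_of_openCover {X : Scheme.{0}} (𝒰 : X.OpenCover)
    {d : WithBot ℕ∞} (hd : ∀ i, topologicalKrullDim (𝒰.X i) ≤ d) : topologicalKrullDim X ≤ d :=
  topologicalKrullDim_le_of_isOpenEmbedding_cover (fun i => (𝒰.f i).base)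
    (fun i => (𝒰.f i).isOpenEmbedding) (fun x => ⟨_, 𝒰.covers x⟩) hd

theorem topologicalKrullDim_le_of_isOpenImmersion {X Y : Scheme.{0}} (f : X ⟶ Y)
    [IsOpenImmersion f] : topologicalKrullDim X ≤ topologicalKrullDim Y :=
  f.isOpenEmbedding.isInducing.topologicalKrullDim_le

theorem topologicalKrullDim_Spec (R : CommRingCat.{0}) :
    topologicalKrullDim (Spec R) = ringKrullDim R :=
  PrimeSpectrum.topologicalKrullDim_eq_ringKrullDim R

theorem topologicalKrullDim_pullback_Spec_le {K : Type} [Field K] {R S : CommRingCat.{0}}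
    (f : Spec R ⟶ Spec (.of K)) (g : Spec S ⟶ Spec (.of K))
    [LocallyOfFiniteType f] [LocallyOfFiniteType g] :
    topologicalKrullDim (pullback f g : Scheme.{0}) ≤ ringKrullDim R + ringKrullDim S := by
  obtain ⟨φ, rfl⟩ := Spec.map_surjective f
  obtain ⟨ψ, rfl⟩ := Spec.map_surjective g
  have hφ : φ.hom.FiniteType := (HasRingHomProperty.Spec_iff (P := @LocallyOfFiniteType)).1 ‹_›
  have hψ : ψ.hom.FiniteType := (HasRingHomProperty.Spec_iff (P := @LocallyOfFiniteType)).1 ‹_›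
  let : Algebra K R := φ.hom.toAlgebra
  let : Algebra K S := ψ.hom.toAlgebra
  have : Algebra.FiniteType K R := hφ
  have : Algebra.FiniteType K S := hψ
  refine le_trans ?_ (ringKrullDim_tensorProduct_le K R S)
  refine le_trans ?_ (topologicalKrullDim_Spec (.of (TensorProduct K R S))).le
  exact topologicalKrullDim_le_of_isOpenImmersion (pullbackSpecIso K R S).hom

theorem topologicalKrullDim_pullback_le {K : Type} [Field K] {X Y : Scheme.{0}}
    (f : X ⟶ Spec (.of K)) (g : Y ⟶ Spec (.of K))
    [LocallyOfFiniteType f] [LocallyOfFiniteType g] :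
    topologicalKrullDim (pullback f g : Scheme.{0}) ≤
      topologicalKrullDim X + topologicalKrullDim Y := by
  refine topologicalKrullDim_le_of_openCover
    (Scheme.Pullback.openCoverOfLeftRight X.affineCover Y.affineCover f g) fun i => ?_
  have hX : LocallyOfFiniteType (X.affineCover.f i.1 ≫ f) := locallyOfFiniteType_comp _ _
  have hY : LocallyOfFiniteType (Y.affineCover.f i.2 ≫ g) := locallyOfFiniteType_comp _ _
  refine (@topologicalKrullDim_pullback_Spec_le K _ _ _ (X.affineCover.f i.1 ≫ f)
    (Y.affineCover.f i.2 ≫ g) hX hY).trans ?_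
  rw [← topologicalKrullDim_Spec, ← topologicalKrullDim_Spec]
  exact add_le_add
    (@topologicalKrullDim_le_of_isOpenImmersion _ _ (X.affineCover.f i.1)
      (X.affineCover.map_prop i.1))
    (@topologicalKrullDim_le_of_isOpenImmersion _ _ (Y.affineCover.f i.2)
      (Y.affineCover.map_prop i.2))

theorem topologicalKrullDim_lt_top {K : Type} [Field K] {X : Scheme.{0}}
    (f : X ⟶ Spec (.of K)) [LocallyOfFiniteType f] [QuasiCompact f] :
    topologicalKrullDim X < ⊤ := by
  have : CompactSpace X := QuasiCompact.compactSpace_of_compactSpace f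
  let 𝒰 := X.affineCover.finiteSubcover
  have hlt : ∀ i, topologicalKrullDim (𝒰.X i) < ⊤ := by
    intro i
    change topologicalKrullDim (Spec _) < ⊤
    rw [topologicalKrullDim_Spec]
    have hi : LocallyOfFiniteType (𝒰.f i ≫ f) := locallyOfFiniteType_comp _ _
    obtain ⟨φ, hφ⟩ := Spec.map_surjective (𝒰.f i ≫ f)
    have hφ : φ.hom.FiniteType :=
      (HasRingHomProperty.Spec_iff (P := @LocallyOfFiniteType)).1 (hφ ▸ hi)
    algebraize [φ.hom]
    exact ringKrullDim_lt_top_of_finiteType K _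
  have : Finite 𝒰.I₀ := inferInstance
  obtain ⟨n, hn⟩ : ∃ n : ℕ, ∀ i, topologicalKrullDim (𝒰.X i) ≤ n := by
    have h : ∀ i, ∃ n : ℕ, topologicalKrullDim (𝒰.X i) ≤ n := fun i =>
      exists_nat_ge_of_lt_top (hlt i)
    choose n hn using h
    obtain ⟨N, hN⟩ := (Set.finite_range n).bddAbove
    exact ⟨N, fun i => (hn i).trans (by exact_mod_cast hN ⟨i, rfl⟩)⟩
  exact (topologicalKrullDim_le_of_openCover 𝒰 hn).trans_lt (natCast_lt_top n)

/-- Finite products over a field exist as fans whose dimension is bounded additively. -/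
theorem exists_fan_topologicalKrullDim_le (K : Type) [Field K] (V : Over (SpecK K))
    (hft : LocallyOfFiniteType V.hom) {d : ℕ} (hd : topologicalKrullDim V.left ≤ d) (n : ℕ) :
    ∃ c : Fan (fun _ : Fin n => V), Nonempty (IsLimit c) ∧ LocallyOfFiniteType c.pt.hom ∧
      topologicalKrullDim c.pt.left ≤ (n * d : ℕ) := by
  induction n with
  | zero =>
    refine ⟨Fan.mk (Over.mk (𝟙 (SpecK K))) fun i => i.elim0,
      ⟨Fan.IsLimit.mk _ (fun s => Over.mkIdTerminal.from s.pt) (fun _ j => j.elim0)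
        fun _ _ _ => Over.mkIdTerminal.hom_ext _ _⟩, ?_, ?_⟩
    · change LocallyOfFiniteType (𝟙 (SpecK K))
      infer_instance
    · change topologicalKrullDim (Spec (.of K)) ≤ _
      rw [topologicalKrullDim_Spec]
      simp
  | succ n ih =>
    obtain ⟨c, ⟨hc⟩, hcf, hcd⟩ := ih
    let t := IsLimit.pullbackConeEquivBinaryFanFunctor
      (pullbackIsPullback V.hom c.pt.hom)
    refine ⟨extendFan c (pullbackConeEquivBinaryFan.functor.obj (pullback.cone V.hom c.pt.hom)),
      ⟨extendFanIsLimit _ hc t⟩, ?_, ?_⟩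
    · change LocallyOfFiniteType (pullback.fst V.hom c.pt.hom ≫ V.hom)
      infer_instance
    · refine (topologicalKrullDim_pullback_le V.hom c.pt.hom).trans ?_
      refine (add_le_add hd hcd).trans ?_
      norm_cast
      rw [add_mul, one_mul, add_comm]

theorem topologicalKrullDim_pow_le (K : Type) [Field K] (V : Over (SpecK K))
    (hft : LocallyOfFiniteType V.hom) {d : ℕ} (hd : topologicalKrullDim V.left ≤ d)
    (Ω : Type) [Finite Ω] :
    topologicalKrullDim (pow K V Ω).left ≤ (Nat.card Ω * d : ℕ) := by
  obtain ⟨c, ⟨hc⟩, -, hcd⟩ := exists_fan_topologicalKrullDim_le K V hft hd (Nat.card Ω)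
  let e : pow K V Ω ≅ c.pt :=
    (Pi.reindex (Finite.equivFin Ω) (fun _ => V)) ≪≫
      (limit.isLimit _).conePointUniqueUpToIso hc
  exact (topologicalKrullDim_le_of_isOpenImmersion ((Over.forget _).mapIso e).hom).trans hcd

/-! ## The Zariski topology on configurations over a finite set -/

theorem isIrreducible_image2 {Y Z T : Type*} [TopologicalSpace Y]
    [TopologicalSpace Z] [TopologicalSpace T] {f : Y → Z → T} (hf₁ : ∀ z, Continuous (f · z))
    (hf₂ : ∀ y, Continuous (f y)) {s : Set Y} {t : Set Z} (hs : IsIrreducible s)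
    (ht : IsIrreducible t) : IsIrreducible (Set.image2 f s t) := by
  refine ⟨hs.nonempty.image2 ht.nonempty, ?_⟩
  rintro U V hU hV ⟨_, ⟨y₁, hy₁, z₁, hz₁, rfl⟩, h₁⟩ ⟨_, ⟨y₂, hy₂, z₂, hz₂, rfl⟩, h₂⟩
  obtain ⟨y, hy, hyU, hyV⟩ := hs.2 _ _ (hU.preimage (hf₁ z₁)) (hV.preimage (hf₁ z₂))
    ⟨y₁, hy₁, h₁⟩ ⟨y₂, hy₂, h₂⟩
  obtain ⟨z, hz, hzU, hzV⟩ := ht.2 _ _ (hU.preimage (hf₂ y)) (hV.preimage (hf₂ y))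
    ⟨z₁, hz₁, hyU⟩ ⟨z₂, hz₂, hyV⟩
  exact ⟨_, ⟨y, hy, z, hz, rfl⟩, hzU, hzV⟩

section Configurations

attribute [local instance] cfgTop

variable {K : Type} [Field K] {V : Over (SpecK K)}

theorem ev_comp_s13 {W W' : Over (SpecK K)} (a : Pt K W) (m : W ⟶ W') :
    ev K (a ≫ m) = m.left.base (ev K a) := by
  simp [ev]

/-- The `K`-point `p`, viewed as a constant morphism. -/
def constHom (W : Over (SpecK K)) (p : Pt K V) : W ⟶ V := Over.mkIdTerminal.from W ≫ p

theorem comp_constHom {W : Over (SpecK K)} (a : Pt K W) (p : Pt K V) : a ≫ constHom W p = p := by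
  rw [constHom, ← Category.assoc, Over.mkIdTerminal.hom_ext (a ≫ Over.mkIdTerminal.from W) (𝟙 _),
    Category.id_comp]

/-- The projection of the fibered power onto the factor `ω`. -/
def powπ {Ω : Type} [Finite Ω] (ω : Ω) : pow K V Ω ⟶ V := Pi.π (fun _ : Ω => V) ω

theorem ptPow_comp_powπ {Ω : Type} [Finite Ω] (u : Ω → Pt K V) (ω : Ω) :
    ptPow K V Ω u ≫ powπ ω = u ω :=
  Pi.lift_π _ ω

theorem ev_ptPow_comp {W : Over (SpecK K)} {Ω : Type} [Finite Ω] (a : Pt K W) (m : Ω → (W ⟶ V)) :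
    ev K (ptPow K V Ω fun ω => a ≫ m ω) = (Pi.lift m : W ⟶ pow K V Ω).left.base (ev K a) := by
  rw [← ev_comp_s13]
  congr 1
  exact Pi.hom_ext _ _ fun ω => by simp [ptPow]

theorem continuous_cfg_comp {Ω Ω' : Type} [Finite Ω] [Finite Ω'] (m : Ω' → (pow K V Ω ⟶ V)) :
    Continuous fun (u : Ω → Pt K V) (ω : Ω') => ptPow K V Ω u ≫ m ω := by
  refine continuous_induced_rng.2 ?_
  have : ((fun u => ev K (ptPow K V Ω' u)) ∘ fun (u : Ω → Pt K V) (ω : Ω') => ptPow K V Ω u ≫ m ω)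
      = (Pi.lift m : pow K V Ω ⟶ pow K V Ω').left.base ∘ fun u => ev K (ptPow K V Ω u) :=
    funext fun u => ev_ptPow_comp _ _
  rw [this]
  exact (Scheme.Hom.continuous _).comp continuous_induced_dom

theorem continuous_cfg_comap {Ω Ω' : Type} [Finite Ω] [Finite Ω'] (r : Ω' → Ω) :
    Continuous fun (u : Ω → Pt K V) => u ∘ r := by
  convert continuous_cfg_comp (V := V) fun ω : Ω' => powπ (r ω) using 3 with u ω
  exact (ptPow_comp_powπ u _).symm

theorem continuous_cfg_extend_left {Ω Λ : Type} [Finite Ω] [Finite Λ] (r : Λ → Ω)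
    (w : Ω → Pt K V) : Continuous fun q : Λ → Pt K V => Function.extend r q w := by
  classical
  convert continuous_cfg_comp (V := V) fun ω : Ω =>
    if h : ∃ l, r l = ω then powπ h.choose else constHom _ (w ω) using 3 with q ω
  rw [Function.extend_def]
  by_cases h : ∃ l, r l = ω
  · rw [dif_pos h, dif_pos h, ptPow_comp_powπ]
  · rw [dif_neg h, dif_neg h, comp_constHom]

theorem continuous_cfg_extend_right {Ω Λ : Type} [Finite Ω] [Finite Λ] (r : Λ → Ω)
    (q : Λ → Pt K V) : Continuous fun w : Ω → Pt K V => Function.extend r q w := by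
  classical
  convert continuous_cfg_comp (V := V) fun ω : Ω =>
    if h : ∃ l, r l = ω then constHom _ (q h.choose) else powπ ω using 3 with w ω
  rw [Function.extend_def]
  by_cases h : ∃ l, r l = ω
  · rw [dif_pos h, dif_pos h, comp_constHom]
  · rw [dif_neg h, dif_neg h, ptPow_comp_powπ]

theorem exists_ev_eq [IsAlgClosed K] (hft : LocallyOfFiniteType V.hom) {x : V.left}
    (hx : IsClosed {x}) : ∃ a : Pt K V, ev K a = x :=
  ⟨Over.homMk (pointOfClosedPoint V.hom x hx) (pointOfClosedPoint_comp V.hom x hx),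
    pointOfClosedPoint_apply V.hom x hx _⟩

theorem exists_ev_mem [IsAlgClosed K] (hft : LocallyOfFiniteType V.hom) {U : Set V.left}
    (hU : IsOpen U) (hne : U.Nonempty) : ∃ a : Pt K V, ev K a ∈ U := by
  have : JacobsonSpace V.left := LocallyOfFiniteType.jacobsonSpace V.hom
  obtain ⟨x, hxU, hx⟩ := nonempty_inter_closedPoints hne hU.isLocallyClosed
  obtain ⟨a, rfl⟩ := exists_ev_eq hft hx
  exact ⟨a, hxU⟩

theorem isIrreducible_univ_unit [IsAlgClosed K] (hft : LocallyOfFiniteType V.hom)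
    [IrreducibleSpace V.left] : IsIrreducible (Set.univ : Set (Unit → Pt K V)) := by
  let _ : TopologicalSpace (Pt K V) := TopologicalSpace.induced (ev K) inferInstance
  have hA : IsIrreducible (Set.univ : Set (Pt K V)) := by
    obtain ⟨a, -⟩ := exists_ev_mem hft isOpen_univ Set.univ_nonempty
    refine ⟨⟨a, trivial⟩, ?_⟩
    rintro _ _ ⟨U, hU, rfl⟩ ⟨U', hU', rfl⟩ ⟨x, -, hx⟩ ⟨y, -, hy⟩
    obtain ⟨b, hb⟩ := exists_ev_mem hft (hU.inter hU')
      (nonempty_preirreducible_inter hU hU' ⟨_, hx⟩ ⟨_, hy⟩)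
    exact ⟨b, trivial, hb⟩
  have hc : Continuous[_, cfgTop K V Unit] fun (a : Pt K V) (_ : Unit) => a := by
    refine continuous_induced_rng.2 ?_
    have : ((fun u => ev K (ptPow K V Unit u)) ∘ fun (a : Pt K V) (_ : Unit) => a)
        = (Pi.lift fun _ => 𝟙 V : V ⟶ pow K V Unit).left.base ∘ ev K := by
      funext a
      simpa using ev_ptPow_comp a fun _ : Unit => 𝟙 V
    rw [this]
    exact (Scheme.Hom.continuous _).comp continuous_induced_dom
  convert! hA.image _ hc.continuousOn
  exact (Set.image_univ_of_surjective fun u => ⟨u (), rfl⟩).symm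

theorem isIrreducible_univ_cfg [IsAlgClosed K] (hft : LocallyOfFiniteType V.hom)
    [IrreducibleSpace V.left] (Ω : Type) [Finite Ω] :
    IsIrreducible (Set.univ : Set (Ω → Pt K V)) := by
  classical
  have := Fintype.ofFinite Ω
  obtain ⟨p, -⟩ := exists_ev_mem hft isOpen_univ Set.univ_nonempty
  suffices h : ∀ S : Finset Ω, IsIrreducible {x : Ω → Pt K V | ∀ ω ∉ S, x ω = p} by
    simpa using h Finset.univ
  intro S
  induction S using Finset.induction_on with
  | empty =>
    convert isIrreducible_singleton (x := fun _ : Ω => p) using 1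
    ext x
    simp [funext_iff]
  | insert a S ha ih =>
    convert isIrreducible_image2 (continuous_cfg_extend_left fun _ : Unit => a)
      (continuous_cfg_extend_right _) (isIrreducible_univ_unit hft) ih using 1
    ext x
    constructor
    · intro hx
      refine ⟨fun _ => x a, trivial, Function.update x a p, fun ω hω => ?_, funext fun ω => ?_⟩
      · by_cases h : ω = a
        · simp [h]
        · simpa [h] using hx ω (by simp [h, hω])
      · by_cases h : ω = a
        · subst h
          exact (Function.injective_of_subsingleton fun _ : Unit => ω).extend_apply _ _ ()
        · rw [Function.extend_apply' _ _ _ (by simpa using Ne.symm h)]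
          simp [h]
    · rintro ⟨q, -, w, hw, rfl⟩ ω hω
      simp only [Finset.mem_insert, not_or] at hω
      rw [Function.extend_apply' _ _ _ (by simpa using Ne.symm hω.1)]
      exact hw ω hω.2

section Blocks

variable {Ω ι : Type} {Λ : ι → Type} (r : ∀ i, Λ i → Ω)

/-- The configurations whose restrictions to the blocks `r i`, for `i ∈ S`, lie in `Q i`. -/
def blockSet {A : Type} (Q : ∀ i, Set (Λ i → A)) (S : Finset ι) : Set (Ω → A) :=
  {x | ∀ i ∈ S, x ∘ r i ∈ Q i}

variable {r}

theorem extend_comp_of_disjoint {A : Type}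
    (hdisj : ∀ i j, i ≠ j → Disjoint (Set.range (r i)) (Set.range (r j))) {i j : ι} (hij : i ≠ j)
    (q : Λ i → A) (w : Ω → A) : Function.extend (r i) q w ∘ r j = w ∘ r j := by
  funext l
  refine Function.extend_apply' _ _ _ ?_
  rintro ⟨l', h⟩
  exact (hdisj i j hij).le_bot ⟨⟨l', h⟩, ⟨l, rfl⟩⟩

theorem blockSet_insert [DecidableEq ι] {A : Type} (hinj : ∀ i, Function.Injective (r i))
    (hdisj : ∀ i j, i ≠ j → Disjoint (Set.range (r i)) (Set.range (r j)))
    (Q : ∀ i, Set (Λ i → A)) {S : Finset ι} {a : ι} (ha : a ∉ S) :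
    blockSet r Q (insert a S) = Set.image2 (Function.extend (r a)) (Q a) (blockSet r Q S) := by
  ext x
  constructor
  · intro hx
    refine ⟨x ∘ r a, hx a (by simp), x, fun i hi => hx i (by simp [hi]), funext fun ω => ?_⟩
    by_cases h : ∃ l, r a l = ω
    · obtain ⟨l, rfl⟩ := h
      exact (hinj a).extend_apply _ _ _
    · exact Function.extend_apply' _ _ _ h
  · rintro ⟨q, hq, w, hw, rfl⟩ i hi
    by_cases h : i = a
    · subst h
      rwa [Function.extend_comp (hinj i)]
    · rw [extend_comp_of_disjoint hdisj (Ne.symm h)]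
      exact hw i ((Finset.mem_insert.1 hi).resolve_left h)

variable [Finite Ω] [∀ i, Finite (Λ i)]

theorem exists_blockSet_coheight [IsAlgClosed K] (hft : LocallyOfFiniteType V.hom)
    [IrreducibleSpace V.left] (hinj : ∀ i, Function.Injective (r i))
    (hdisj : ∀ i j, i ≠ j → Disjoint (Set.range (r i)) (Set.range (r j)))
    (Q : ∀ i, Set (Λ i → Pt K V)) (S : Finset ι) (hirr : ∀ i, IsIrreducible (Q i))
    (hcl : ∀ i, IsClosed (Q i)) (hne : ∀ i, Q i ≠ Set.univ) :
    ∃ C : TopologicalSpace.IrreducibleCloseds (Ω → Pt K V),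
      (C : Set (Ω → Pt K V)) = blockSet r Q S ∧ (S.card : ℕ∞) ≤ Order.coheight C := by
  classical
  induction S using Finset.induction_on with
  | empty =>
    refine ⟨⟨Set.univ, isIrreducible_univ_cfg hft Ω, isClosed_univ⟩, ?_, by simp⟩
    simp [blockSet]
  | insert a S ha ih =>
    obtain ⟨C, hC, hcard⟩ := ih
    have hsub : blockSet r Q (insert a S) ⊆ blockSet r Q S := fun x hx i hi =>
      hx i (Finset.mem_insert_of_mem hi)
    have hirr' : IsIrreducible (blockSet r Q (insert a S)) := by
      rw [blockSet_insert hinj hdisj Q ha, ← hC]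
      exact isIrreducible_image2 (continuous_cfg_extend_left _) (continuous_cfg_extend_right _)
        (hirr a) C.isIrreducible
    have hcl' : IsClosed (blockSet r Q (insert a S)) := by
      have : blockSet r Q (insert a S) =
          (C : Set (Ω → Pt K V)) ∩ (fun x => x ∘ r a) ⁻¹' Q a := by
        rw [hC]
        ext x
        simp [blockSet, and_comm]
      rw [this]
      exact C.isClosed.inter ((hcl a).preimage (continuous_cfg_comap _))
    refine ⟨⟨_, hirr', hcl'⟩, rfl, ?_⟩
    rw [Finset.card_insert_of_notMem ha, Nat.cast_add, Nat.cast_one]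
    refine (add_le_add_left hcard 1).trans (Order.coheight_add_one_le ?_)
    have hle : blockSet r Q (insert a S) ⊂ C := by
      rw [hC]
      refine ⟨hsub, fun h => ?_⟩
      obtain ⟨y, hy⟩ := (Set.ne_univ_iff_exists_notMem _).1 (hne a)
      obtain ⟨w, hw⟩ := C.isIrreducible.nonempty
      rw [hC] at hw
      have hmem : Function.extend (r a) y w ∈ blockSet r Q S := by
        intro i hi
        rw [extend_comp_of_disjoint hdisj (by rintro rfl; exact ha hi)]
        exact hw i hi
      have := h hmem a (Finset.mem_insert_self _ _)
      rw [Function.extend_comp (hinj a)] at this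
      exact hy this
    exact hle

theorem cfgDim_add_card_le [IsAlgClosed K] (hft : LocallyOfFiniteType V.hom)
    [IrreducibleSpace V.left] [Finite ι] (hinj : ∀ i, Function.Injective (r i))
    (hdisj : ∀ i j, i ≠ j → Disjoint (Set.range (r i)) (Set.range (r j)))
    (Z : ∀ i, Set (Λ i → Pt K V)) (hcl : ∀ i, IsClosed (Z i)) (hne : ∀ i, Z i ≠ Set.univ)
    (D : Set (Ω → Pt K V)) (hD : ∀ x ∈ D, ∀ i, x ∘ r i ∈ Z i) :
    cfgDim K V Ω D + (Nat.card ι : ℕ) ≤ topologicalKrullDim (pow K V Ω).left := by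
  classical
  have := Fintype.ofFinite ι
  have hamb : topologicalKrullDim (Ω → Pt K V) ≤ topologicalKrullDim (pow K V Ω).left :=
    IsInducing.topologicalKrullDim_le (f := fun u => ev K (ptPow K V Ω u)) ⟨rfl⟩
  refine le_trans ?_ hamb
  rw [cfgDim, topologicalKrullDim]
  cases isEmpty_or_nonempty (TopologicalSpace.IrreducibleCloseds D) with
  | inl h => simp [Order.krullDim_eq_bot]
  | inr h =>
  have key : ∀ C : TopologicalSpace.IrreducibleCloseds D,
      ((Order.height C + Nat.card ι : ℕ∞) : WithBot ℕ∞) ≤ topologicalKrullDim (Ω → Pt K V) := by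
    intro C
    let m := TopologicalSpace.IrreducibleCloseds.map (Subtype.val : D → Ω → Pt K V)
      continuous_subtype_val
    have hm : StrictMono m :=
      TopologicalSpace.IrreducibleCloseds.map_strictMono_of_isInducing IsInducing.subtypeVal
    let Q : ∀ i, Set (Λ i → Pt K V) := fun i =>
      closure ((fun x => x ∘ r i) '' (Subtype.val '' (C : Set D)))
    have hQZ : ∀ i, Q i ⊆ Z i := fun i => closure_minimal
      (by rintro _ ⟨_, ⟨x, -, rfl⟩, rfl⟩; exact hD x x.2 i) (hcl i)
    obtain ⟨P, hP, hcard⟩ := exists_blockSet_coheight hft hinj hdisj Q Finset.univ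
      (fun i => ((C.isIrreducible.image _ continuous_subtype_val.continuousOn).image _
        (continuous_cfg_comap _).continuousOn).closure)
      (fun i => isClosed_closure)
      (fun i h => hne i (Set.univ_subset_iff.1 (h ▸ hQZ i)))
    have hmP : m C ≤ P := by
      change closure (Subtype.val '' (C : Set D)) ⊆ (P : Set (Ω → Pt K V))
      refine closure_minimal ?_ P.isClosed
      rw [hP]
      exact fun x hx i _ => subset_closure ⟨x, hx, rfl⟩
    have h1 : Order.height C ≤ Order.height P :=
      (Order.height_le_height_apply_of_strictMono m hm C).trans (Order.height_mono hmP)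
    rw [Finset.card_univ, ← Nat.card_eq_fintype_card] at hcard
    have : Nonempty (TopologicalSpace.IrreducibleCloseds (Ω → Pt K V)) := ⟨P⟩
    rw [topologicalKrullDim, Order.krullDim_eq_iSup_height_add_coheight_of_nonempty]
    exact WithBot.coe_le_coe.2 ((add_le_add h1 hcard).trans
      (le_iSup (fun a : TopologicalSpace.IrreducibleCloseds (Ω → Pt K V) =>
        Order.height a + Order.coheight a) P))
  rw [Order.krullDim_eq_iSup_height_of_nonempty]
  have hcast : ((Nat.card ι : ℕ) : WithBot ℕ∞) = ((Nat.card ι : ℕ∞) : WithBot ℕ∞) := rfl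
  rw [hcast, ← WithBot.coe_add, ENat.iSup_add]
  rw [WithBot.coe_iSup (OrderTop.bddAbove _)]
  exact iSup_le key

end Blocks

end Configurations

/-! ## Counting the tiles contained in a finite set -/

section Counting

open scoped Pointwise

variable {G : Type} [Group G] [DecidableEq G]

open Classical in
/-- The elements `g` of `T`, restricted to `F * e₀⁻¹`, whose tile `g * E` is contained in `F`. -/
def innerTiles (E : Finset G) (e₀ : G) (T : Set G) (F : Finset G) : Finset G :=
  (F.image (· * e₀⁻¹)).filter fun g => g ∈ T ∧ E.image (g * ·) ⊆ F

theorem mem_innerTiles {E : Finset G} {e₀ : G} {T : Set G} {F : Finset G} {g : G} :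
    g ∈ innerTiles E e₀ T F ↔
      g ∈ F.image (· * e₀⁻¹) ∧ g ∈ T ∧ E.image (g * ·) ⊆ F := by
  simp [innerTiles]

theorem card_le_innerTiles {E E' : Finset G} {T : Set G}
    (hcov : ∀ x : G, ∃ g ∈ T, x ∈ (g * ·) '' (E' : Set G)) {e₀ : G} (he₀ : e₀ ∈ E)
    (F : Finset G) :
    F.card ≤ (innerTiles E e₀ T F).card * E'.card +
      ∑ g ∈ (E'⁻¹ * E)⁻¹, ((F : Set G) \ ((· * g) '' (F : Set G))).ncard := by
  have hsub : F ⊆ innerTiles E e₀ T F * E' ∪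
      ((E'⁻¹ * E)⁻¹).biUnion fun g => F \ F.image (· * g) := by
    intro x hx
    by_cases hxF : ∃ g ∈ (E'⁻¹ * E)⁻¹, x ∉ F.image (· * g)
    · obtain ⟨g, hg, hxg⟩ := hxF
      exact Finset.mem_union_right _
        (Finset.mem_biUnion.2 ⟨g, hg, Finset.mem_sdiff.2 ⟨hx, hxg⟩⟩)
    · push Not at hxF
      obtain ⟨g, hgT, e', he', rfl⟩ := hcov x
      have hgE : ∀ e ∈ E, g * e ∈ F := by
        intro e he
        obtain ⟨y, hy, hyx⟩ := Finset.mem_image.1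
          (hxF _ (Finset.inv_mem_inv (Finset.mul_mem_mul (Finset.inv_mem_inv he') he)))
        have : y = g * e := by
          rw [← eq_mul_inv_iff_mul_eq] at hyx
          simpa [mul_assoc] using hyx
        exact this ▸ hy
      refine Finset.mem_union_left _ (Finset.mul_mem_mul ?_ he')
      refine mem_innerTiles.2 ⟨Finset.mem_image.2 ⟨g * e₀, hgE e₀ he₀, by simp⟩, hgT, ?_⟩
      exact Finset.image_subset_iff.2 hgE
  refine (Finset.card_le_card hsub).trans ((Finset.card_union_le _ _).trans ?_)
  refine add_le_add Finset.card_mul_le (Finset.card_biUnion_le.trans (Finset.sum_le_sum ?_))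
  intro g _
  rw [← Finset.coe_image, ← Finset.coe_sdiff, Set.ncard_coe_finset]

theorem eventually_card_le_innerTiles (𝓕 : FolnerNet G) {E E' : Finset G} {T : Set G}
    (hcov : ∀ x : G, ∃ g ∈ T, x ∈ (g * ·) '' (E' : Set G)) {e₀ : G} (he₀ : e₀ ∈ E) :
    ∀ᶠ i in atTop, (1 / (2 * E'.card) : ℝ) * (𝓕.F i).card ≤
      (innerTiles E e₀ T (𝓕.F i)).card := by
  have hE' : 0 < (E'.card : ℝ) := by
    obtain ⟨_, _, e', he', _⟩ := hcov 1
    exact_mod_cast Finset.card_pos.2 ⟨e', he'⟩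
  have hlim := tendsto_finsetSum (E'⁻¹ * E)⁻¹ fun g _ => 𝓕.folner g
  rw [Finset.sum_const_zero] at hlim
  filter_upwards [hlim.eventually (gt_mem_nhds (show (0 : ℝ) < 1 / 2 by norm_num))] with i hi
  have hF : 0 < ((𝓕.F i).card : ℝ) := by exact_mod_cast (𝓕.nonempty i).card_pos
  rw [← Finset.sum_div, div_lt_iff₀ hF] at hi
  have h : ((𝓕.F i).card : ℝ) ≤ (innerTiles E e₀ T (𝓕.F i)).card * E'.card +
      ∑ g ∈ (E'⁻¹ * E)⁻¹, (((𝓕.F i : Set G) \ ((· * g) '' (𝓕.F i : Set G))).ncard : ℝ) := by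
    exact_mod_cast card_le_innerTiles hcov he₀ (𝓕.F i)
  rw [div_mul_eq_mul_div, one_mul, div_le_iff₀ (by positivity)]
  linarith

end Counting

/-! ## Mean dimension -/

theorem dimE_bot : dimE ⊥ = ⊥ := rfl

theorem dimE_natCast (n : ℕ) : dimE n = ((n : ℝ) : EReal) := by
  change (((n : ℕ∞) : ℝ≥0∞) : EReal) = _
  rw [ENat.toENNReal_coe]
  rfl

theorem dimE_mul_inv_le {a : WithBot ℕ∞} {s n d : ℕ} (hn : 0 < n) {c : ℝ} (hs : c * n ≤ s)
    (h : a + (s : ℕ) ≤ (n * d : ℕ)) :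
    dimE a * (((n : ℝ)⁻¹ : ℝ) : EReal) ≤ ((d - c : ℝ) : EReal) := by
  have hn' : (0 : ℝ) < n := by exact_mod_cast hn
  induction a using WithBot.recBotCoe with
  | bot =>
    rw [dimE_bot, EReal.bot_mul_coe_of_pos (inv_pos.2 hn')]
    exact bot_le
  | coe a =>
    have ha : a + (s : ℕ) ≤ ((n * d : ℕ) : ℕ∞) := by
      rw [← WithBot.coe_le_coe]
      exact h
    obtain ⟨m, rfl⟩ := ENat.ne_top_iff_exists.1
      (ne_top_of_le_ne_top (ENat.natCast_ne_top _) (le_self_add.trans ha))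
    have ha' : (m + s : ℝ) ≤ n * d := by exact_mod_cast ha
    change dimE ((m : ℕ) : WithBot ℕ∞) * _ ≤ _
    rw [dimE_natCast, ← EReal.coe_mul, EReal.coe_le_coe_iff, ← div_eq_mul_inv, div_le_iff₀ hn']
    linarith

theorem restr_add_card_innerTiles_le {K : Type} [Field K] [IsAlgClosed K] {V : Over (SpecK K)}
    (hft : LocallyOfFiniteType V.hom) [IrreducibleSpace V.left] {G : Type} [Group G]
    [DecidableEq G] {Γ : Set (G → Pt K V)} {E : Finset G} {T : Set G}
    (hdisj : ∀ g ∈ T, ∀ h ∈ T, g ≠ h →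
      Disjoint ((g * ·) '' (E : Set G)) ((h * ·) '' (E : Set G)))
    (hΓ : ∀ g ∈ T, cfgClosed K V ↥(E.image (g * ·)) (restr K V Γ (E.image (g * ·))) ∧
      restr K V Γ (E.image (g * ·)) ≠ Set.univ) (e₀ : G) (F : Finset G) :
    cfgDim K V ↥F (restr K V Γ F) + ((innerTiles E e₀ T F).card : ℕ) ≤
      topologicalKrullDim (pow K V ↥F).left := by
  have hmem : ∀ g : ↥(innerTiles E e₀ T F), (g : G) ∈ T ∧ E.image ((g : G) * ·) ⊆ F :=
    fun g => (mem_innerTiles.1 g.2).2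
  have h := cfgDim_add_card_le (Ω := ↥F) (ι := ↥(innerTiles E e₀ T F))
    (Λ := fun g => ↥(E.image ((g : G) * ·))) (r := fun g => Set.inclusion (hmem g).2) hft
    (fun g => Set.inclusion_injective _) ?_
    (fun g => restr K V Γ (E.image ((g : G) * ·))) (fun g => (hΓ g (hmem g).1).1)
    (fun g => (hΓ g (hmem g).1).2) (restr K V Γ F) ?_
  · rwa [Nat.card_eq_fintype_card, Fintype.card_coe] at h
  · intro g h hgh
    refine Set.disjoint_left.2 ?_
    rintro _ ⟨x, rfl⟩ ⟨y, hxy⟩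
    have hxy' : (y : G) = x := congrArg Subtype.val hxy
    have hx := x.2
    have hy := y.2
    rw [hxy'] at hy
    rw [← Finset.mem_coe, Finset.coe_image] at hx hy
    exact (hdisj g (hmem g).1 h (hmem h).1 fun e => hgh (Subtype.ext e)).le_bot ⟨hx, hy⟩
  · rintro _ ⟨c, hc, rfl⟩ g
    exact ⟨c, hc, rfl⟩

theorem mdim_empty {K : Type} [Field K] {V : Over (SpecK K)} {G : Type} [Group G]
    (𝓕 : FolnerNet G) : mdim K V 𝓕 ∅ = ⊥ := by
  have : ∀ i, dimE (cfgDim K V ↥(𝓕.F i) (restr K V ∅ (𝓕.F i))) *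
      ((((𝓕.F i).card : ℝ)⁻¹ : ℝ) : EReal) = ⊥ := by
    intro i
    have hF : 0 < ((𝓕.F i).card : ℝ) := by exact_mod_cast (𝓕.nonempty i).card_pos
    have h : cfgDim K V ↥(𝓕.F i) (restr K V ∅ (𝓕.F i)) = ⊥ := by
      rw [restr, Set.image_empty]
      let _ := cfgTop K V ↥(𝓕.F i)
      exact Order.krullDim_eq_bot_iff.2 ⟨fun C :
        TopologicalSpace.IrreducibleCloseds (∅ : Set (↥(𝓕.F i) → Pt K V)) =>
          C.isIrreducible.nonempty.elim fun x _ => x.2⟩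
    rw [h, dimE_bot, EReal.bot_mul_coe_of_pos (inv_pos.2 hF)]
  simp only [mdim, this]
  exact limsup_const _

/-- Lemma 5.2. Let `G` be an amenable group with a Følner net `𝓕`,
`X` an irreducible algebraic variety over an algebraically closed field `K`, and
`A := X(K)`. If `Γ ⊆ A^G` is such that there exist finite subsets `E, E' ⊆ G` and an
`(E,E')`-tiling `T ⊆ G` with `Γ_{gE}` a proper Zariski-closed subset of `A^{gE}` for
every `g ∈ T`, then `mdim_𝓕(Γ) < dim X`. -/
theorem mdim_lt_of_tiling
    (G : Type) [Group G] [DecidableEq G] (𝓕 : FolnerNet G)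
    (K : Type) [Field K] [IsAlgClosed K]
    (V : Over (SpecK K)) (hft : LocallyOfFiniteType V.hom) (hqc : QuasiCompact V.hom)
    (hirr : IrreducibleSpace V.left)
    (Γ : Set (G → Pt K V))
    (htile : ∃ (E E' : Finset G) (T : Set G), IsTiling E E' T ∧
      ∀ g ∈ T, cfgClosed K V ↥(E.image (g * ·)) (restr K V Γ (E.image (g * ·))) ∧
        restr K V Γ (E.image (g * ·)) ≠ Set.univ) :
    mdim K V 𝓕 Γ < dimE (vdim K V) := by
  obtain ⟨E, E', T, ⟨hdisj, hcov⟩, hΓ⟩ := htile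
  have hdim : ∃ d : ℕ, vdim K V = d := by
    obtain ⟨n, hn⟩ := exists_nat_ge_of_lt_top (topologicalKrullDim_lt_top V.hom)
    have h0 : 0 ≤ vdim K V := by
      have : Nonempty (TopologicalSpace.IrreducibleCloseds V.left) :=
        ⟨⟨Set.univ, IrreducibleSpace.isIrreducible_univ _, isClosed_univ⟩⟩
      exact Order.krullDim_nonneg
    change vdim K V ≤ n at hn
    generalize vdim K V = v at h0 hn
    induction v with
    | bot => simp at h0
    | coe v =>
      lift v to ℕ using ne_top_of_le_ne_top (ENat.natCast_ne_top n) (WithBot.coe_le_coe.1 hn)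
      exact ⟨v, rfl⟩
  obtain ⟨d, hd⟩ := hdim
  rw [hd, dimE_natCast]
  obtain rfl | ⟨e₀, he₀⟩ := E.eq_empty_or_nonempty
  · have hΓe : Γ = ∅ := by
      obtain ⟨g, hg, -⟩ := hcov 1
      by_contra hne
      obtain ⟨c, hc⟩ := Set.nonempty_iff_ne_empty.2 hne
      refine (hΓ g hg).2 (Set.eq_univ_of_forall fun x => ⟨c, hc, funext fun ω => ?_⟩)
      simpa using ω.2
    rw [hΓe, mdim_empty]
    exact EReal.bot_lt_coe _
  · have hE' : 0 < (E'.card : ℝ) := by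
      obtain ⟨_, _, e', he', _⟩ := hcov 1
      exact_mod_cast Finset.card_pos.2 ⟨e', he'⟩
    refine lt_of_le_of_lt (b := ((d - 1 / (2 * E'.card) : ℝ) : EReal)) ?_ ?_
    · refine limsup_le_of_le (h := ?_)
      filter_upwards [eventually_card_le_innerTiles 𝓕 hcov he₀] with i hi
      refine dimE_mul_inv_le (𝓕.nonempty i).card_pos hi
        ((restr_add_card_innerTiles_le hft hdisj hΓ e₀ (𝓕.F i)).trans ?_)
      convert topologicalKrullDim_pow_le K V hft hd.le ↥(𝓕.F i) using 3
      simp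
    · rw [EReal.coe_lt_coe_iff]
      have : (0 : ℝ) < 1 / (2 * E'.card) := by positivity
      linarith

end GOE
end
end
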